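/- For every irrational θ ∈ (0,1), liminf_{t→0⁺} √t · ∑_{n=1}^{∞} sin²(πθn) e^{−n²t/2} ≥ 1/(√2·e). -/

import Mathlib

open Filter Topology

lemma two_sin_mul_sum_sin_sq (a : ℝ) (N : ℕ) :
    2 * Real.sin a * ∑ n ∈ Finset.range N, Real.sin (a * ((n : ℝ) + 1)) ^ 2 =
      Real.sin a * N - (Real.sin (a * (2 * N + 1)) - Real.sin a) / 2 := by
  induction N with
  | zero => simp
  | succ k ih =>
    rw [Finset.sum_range_succ, mul_add, ih]
    have h1 : a * (2 * ((k + 1 : ℕ) : ℝ) + 1) = 2 * (a * ((k : ℝ) + 1)) + a := by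
      push_cast; ring
    have h2 : a * (2 * (k : ℝ) + 1) = 2 * (a * ((k : ℝ) + 1)) - a := by ring
    rw [h1, h2, Real.sin_add, Real.sin_sub, Real.cos_two_mul, Real.cos_sq']
    push_cast
    ring

lemma le_sum_sin_sq {a : ℝ} (ha : 0 < Real.sin a) (N : ℕ) :
    (N : ℝ) / 2 - 1 / (2 * Real.sin a) ≤
      ∑ n ∈ Finset.range N, Real.sin (a * ((n : ℝ) + 1)) ^ 2 := by
  have h := two_sin_mul_sum_sin_sq a N
  have h1 := Real.sin_le_one (a * (2 * N + 1))
  have h2 : 2 * Real.sin a * ((N : ℝ) / 2 - 1 / (2 * Real.sin a)) = Real.sin a * N - 1 := by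
    field_simp
  refine le_of_mul_le_mul_left ?_ (by positivity : 0 < 2 * Real.sin a)
  rw [h, h2]
  linarith

lemma sin_sq_mul_gaussian_le_geometric {t : ℝ} (ht : 0 ≤ t) (x : ℝ) (n : ℕ) :
    Real.sin x ^ 2 * Real.exp (-((n : ℝ) + 1) ^ 2 * t / 2) ≤
      Real.exp (1 / 2) * Real.exp (-√t) * Real.exp (-√t) ^ n := by
  calc Real.sin x ^ 2 * Real.exp (-((n : ℝ) + 1) ^ 2 * t / 2)
      ≤ 1 * Real.exp (-((n : ℝ) + 1) ^ 2 * t / 2) := by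
        gcongr
        exact Real.sin_sq_le_one x
    _ ≤ Real.exp (1 / 2 + -√t + n * -√t) := by
        rw [one_mul, Real.exp_le_exp]
        nlinarith [sq_nonneg (((n : ℝ) + 1) * √t - 1), Real.sq_sqrt ht]
    _ = _ := by rw [Real.exp_add, Real.exp_add, Real.exp_nat_mul]

lemma summable_exp_neg_sqrt_pow {t : ℝ} (ht : 0 < t) :
    Summable fun n : ℕ => Real.exp (1 / 2) * Real.exp (-√t) * Real.exp (-√t) ^ n :=
  (summable_geometric_of_lt_one (Real.exp_pos _).le
    (Real.exp_lt_one_iff.2 (neg_neg_of_pos (Real.sqrt_pos.2 ht)))).mul_left _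

lemma summable_sin_sq_mul_gaussian {t : ℝ} (ht : 0 < t) (x : ℕ → ℝ) :
    Summable fun n : ℕ => Real.sin (x n) ^ 2 * Real.exp (-((n : ℝ) + 1) ^ 2 * t / 2) :=
  (summable_exp_neg_sqrt_pow ht).of_nonneg_of_le (fun _ => by positivity)
    fun n => sin_sq_mul_gaussian_le_geometric ht.le (x n) n

lemma sqrt_mul_tsum_sin_sq_mul_gaussian_le {t : ℝ} (ht : 0 < t) (x : ℕ → ℝ) :
    √t * ∑' n : ℕ, Real.sin (x n) ^ 2 * Real.exp (-((n : ℝ) + 1) ^ 2 * t / 2) ≤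
      Real.exp (1 / 2) := by
  have hs := Real.sqrt_pos.2 ht
  have hlt : Real.exp (-√t) < 1 := Real.exp_lt_one_iff.2 (neg_neg_of_pos hs)
  have h := (summable_sin_sq_mul_gaussian ht x).tsum_le_tsum
    (fun n => sin_sq_mul_gaussian_le_geometric ht.le (x n) n) (summable_exp_neg_sqrt_pow ht)
  rw [tsum_mul_left, tsum_geometric_of_lt_one (Real.exp_pos _).le hlt] at h
  have key : √t * Real.exp (-√t) ≤ 1 - Real.exp (-√t) := by
    have h1 : (√t + 1) * Real.exp (-√t) ≤ Real.exp √t * Real.exp (-√t) := by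
      gcongr
      exact Real.add_one_le_exp _
    rw [← Real.exp_add, add_neg_cancel, Real.exp_zero] at h1
    linarith
  calc _ ≤ √t * (Real.exp (1 / 2) * Real.exp (-√t) * (1 - Real.exp (-√t))⁻¹) := by gcongr
    _ = Real.exp (1 / 2) * (√t * Real.exp (-√t) / (1 - Real.exp (-√t))) := by ring
    _ ≤ Real.exp (1 / 2) * 1 := by
        gcongr
        exact (div_le_one (sub_pos.2 hlt)).2 key
    _ = _ := mul_one _

lemma le_sqrt_mul_tsum_sin_sq_mul_gaussian {a t : ℝ} (ha : 0 < Real.sin a) (ht : 0 < t) :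
    Real.exp (-1) * (√2 / 2 - √t * (1 / 2 + 1 / (2 * Real.sin a))) ≤
      √t * ∑' n : ℕ, Real.sin (a * ((n : ℝ) + 1)) ^ 2 *
        Real.exp (-((n : ℝ) + 1) ^ 2 * t / 2) := by
  have hs := Real.sqrt_pos.2 ht
  set N := ⌊√2 / √t⌋₊
  have hN : √2 / √t - 1 ≤ N := (Nat.sub_one_lt_floor _).le
  have hN' : (N : ℝ) * √t ≤ √2 := (le_div_iff₀ hs).1 (Nat.floor_le (by positivity))
  have hexp : ∀ n ∈ Finset.range N,
      Real.sin (a * ((n : ℝ) + 1)) ^ 2 * Real.exp (-1) ≤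
        Real.sin (a * ((n : ℝ) + 1)) ^ 2 * Real.exp (-((n : ℝ) + 1) ^ 2 * t / 2) := by
    intro n hn
    have hn' : (n : ℝ) + 1 ≤ N := by exact_mod_cast Finset.mem_range.1 hn
    have h1 : ((n : ℝ) + 1) * √t ≤ √2 := le_trans (by gcongr) hN'
    have h2 : (((n : ℝ) + 1) * √t) ^ 2 ≤ √2 ^ 2 := by gcongr
    rw [mul_pow, Real.sq_sqrt ht.le, Real.sq_sqrt zero_le_two] at h2
    gcongr
    linarith
  have hsum := (Finset.sum_le_sum hexp).trans
    ((summable_sin_sq_mul_gaussian ht fun n => a * ((n : ℝ) + 1)).sum_le_tsum _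
      fun _ _ => by positivity)
  rw [← Finset.sum_mul] at hsum
  calc _ = √t * (((√2 / √t - 1) / 2 - 1 / (2 * Real.sin a)) * Real.exp (-1)) := by
        field_simp
        ring
    _ ≤ √t * ((N / 2 - 1 / (2 * Real.sin a)) * Real.exp (-1)) := by gcongr
    _ ≤ √t * ((∑ n ∈ Finset.range N, Real.sin (a * ((n : ℝ) + 1)) ^ 2) * Real.exp (-1)) := by
        gcongr
        exact le_sum_sin_sq ha N
    _ ≤ _ := by gcongr

/-- For every irrational `θ ∈ (0,1)`,
`liminf_{t→0⁺} √t · ∑_{n=1}^{∞} sin²(πθn) e^{−n²t/2} ≥ 1/(√2·e)`. -/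
theorem liminf_sin_sq_gaussian_lower_bound
    (θ : ℝ) (hθmem : θ ∈ Set.Ioo (0 : ℝ) 1) (hθ : Irrational θ) :
    1 / (Real.sqrt 2 * Real.exp 1) ≤
      Filter.liminf
        (fun t : ℝ => Real.sqrt t *
          ∑' n : ℕ, Real.sin (Real.pi * θ * ((n : ℝ) + 1)) ^ 2 *
            Real.exp (-((n : ℝ) + 1) ^ 2 * t / 2))
        (𝓝[>] 0) := by
  have ha : 0 < Real.sin (Real.pi * θ) :=
    Real.sin_pos_of_pos_of_lt_pi (mul_pos Real.pi_pos hθmem.1)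
      (mul_lt_of_lt_one_right Real.pi_pos hθmem.2)
  have hlim : Tendsto (fun t : ℝ =>
      Real.exp (-1) * (√2 / 2 - √t * (1 / 2 + 1 / (2 * Real.sin (Real.pi * θ)))))
      (𝓝[>] 0) (𝓝 (1 / (√2 * Real.exp 1))) := by
    have hcont : Continuous fun t : ℝ =>
        Real.exp (-1) * (√2 / 2 - √t * (1 / 2 + 1 / (2 * Real.sin (Real.pi * θ)))) := by
      fun_prop
    have h0 : Real.exp (-1) * (√2 / 2 - √0 * (1 / 2 + 1 / (2 * Real.sin (Real.pi * θ)))) =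
        1 / (√2 * Real.exp 1) := by
      rw [Real.sqrt_zero, zero_mul, sub_zero, Real.sqrt_div_self', Real.exp_neg]
      field_simp
    exact h0 ▸ (hcont.tendsto 0).mono_left nhdsWithin_le_nhds
  rw [← hlim.liminf_eq]
  refine liminf_le_liminf ?_ hlim.isBoundedUnder_ge
    (IsBoundedUnder.isCoboundedUnder_ge ⟨Real.exp (1 / 2), eventually_map.2 ?_⟩)
  · filter_upwards [self_mem_nhdsWithin] with t ht
    exact le_sqrt_mul_tsum_sin_sq_mul_gaussian ha ht
  · filter_upwards [self_mem_nhdsWithin] with t ht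
    exact sqrt_mul_tsum_sin_sq_mul_gaussian_le ht _
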